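/- Let X = {0,1} with the uniform metric d(0,1) = 1, start point p₀ = 0, let D be a positive integer and q ∈ (0, 1/2) with qD a positive integer, and set n = (1+q)D. Define the predicted sequence ŝ by ŝ(t) = 1 for 1 ≤ t ≤ (1−q)D and ŝ(t) = 0 for (1−q)D < t ≤ n; define s¹ = ŝ and s²(t) = 1 for all t (each of s¹, s² differs from ŝ in at most 2qD positions). Then for every deterministic online algorithm, given by functions f_t : X^t → X for t = 1,…,n inducing on input s the position sequence a_s with a_s(0) = 0 and a_s(t) = f_t(s(1),…,s(t)), there exists s ∈ {s¹, s²} with cost(a_s, s) ≥ (1+q)·OPT(s). -/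

import Mathlib

open Finset

/-- Total cost of position sequence `a` serving requests `s 1, …, s n`:
`∑ t, (D * d(a (t-1), a t) + d(a t, s t))`. -/
noncomputable def pmCost {X : Type*} [MetricSpace X] (D : ℝ) (n : ℕ) (a s : ℕ → X) : ℝ :=
  ∑ t ∈ Finset.Icc 1 n, (D * dist (a (t - 1)) (a t) + dist (a t) (s t))

/-- Optimal offline cost: infimum of `pmCost` over all position sequences
(maps `b : ℕ → X` with `b 0 = p₀`). -/
noncomputable def pmOPT {X : Type*} [MetricSpace X] (D : ℝ) (p₀ : X) (n : ℕ) (s : ℕ → X) : ℝ :=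
  sInf {c : ℝ | ∃ b : ℕ → X, b 0 = p₀ ∧ pmCost D n b s = c}

open Classical in
/-- Number of mismatches between `s` and `shat` on the index set `I`. -/
noncomputable def mismatches {X : Type*} (s shat : ℕ → X) (I : Finset ℕ) : ℕ :=
  (I.filter fun t => s t ≠ shat t).card


/-- The two-point space `X = {0, 1}` (as a subspace of `ℝ`), which carries the uniform
metric: the distance between its two distinct points is `1`. -/
abbrev X01 : Type := ({0, 1} : Set ℝ)

/-- The point `0 ∈ {0,1}`, the start position. -/
noncomputable def x0 : X01 := ⟨0, by simp⟩

/-- The point `1 ∈ {0,1}`. -/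
noncomputable def x1 : X01 := ⟨1, by simp⟩

theorem X01.eq_x0_or_eq_x1 (x : X01) : x = x0 ∨ x = x1 := by
  obtain ⟨x, rfl | rfl⟩ := x
  · exact Or.inl rfl
  · exact Or.inr rfl

theorem dist_x0_x1 : dist x0 x1 = 1 := by
  simp [x0, x1, Subtype.dist_eq]

section PageMigration

variable {X : Type*} [MetricSpace X]

theorem pmCost_eq (D : ℝ) (n : ℕ) (a s : ℕ → X) :
    pmCost D n a s = D * ∑ t ∈ Finset.Icc 1 n, dist (a (t - 1)) (a t) +
      ∑ t ∈ Finset.Icc 1 n, dist (a t) (s t) := by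
  rw [pmCost, Finset.sum_add_distrib, Finset.mul_sum]

theorem pmCost_nonneg {D : ℝ} (hD : 0 ≤ D) (n : ℕ) (a s : ℕ → X) : 0 ≤ pmCost D n a s :=
  Finset.sum_nonneg fun _ _ => by positivity

theorem pmOPT_le_pmCost {D : ℝ} (hD : 0 ≤ D) {p₀ : X} (n : ℕ) (s : ℕ → X) {b : ℕ → X}
    (hb : b 0 = p₀) : pmOPT D p₀ n s ≤ pmCost D n b s := by
  refine csInf_le ⟨0, ?_⟩ ⟨b, hb, rfl⟩
  rintro _ ⟨c, -, rfl⟩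
  exact pmCost_nonneg hD n c s

theorem dist_le_sum_Icc_dist (a : ℕ → X) {m n : ℕ} (hmn : m ≤ n) :
    dist (a 0) (a m) ≤ ∑ t ∈ Finset.Icc 1 n, dist (a (t - 1)) (a t) := by
  have h : ∑ t ∈ Finset.range n, dist (a t) (a (t + 1)) =
      ∑ t ∈ Finset.Icc 1 n, dist (a (t - 1)) (a t) := by
    rw [← Finset.Ico_add_one_right_eq_Icc, Finset.sum_Ico_eq_sum_range]
    simp [add_comm]
  rw [← h]
  exact (dist_le_range_sum_dist a m).trans
    (Finset.sum_le_sum_of_subset_of_nonneg (Finset.range_mono hmn) fun _ _ _ => dist_nonneg)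

/-- The movement up to time `m` and the service up to time `T` bound the cost from below. -/
theorem mul_dist_add_sum_le_pmCost {D : ℝ} (hD : 0 ≤ D) {m n T : ℕ} (hm : m ≤ n) (hT : T ≤ n)
    (a s : ℕ → X) :
    D * dist (a 0) (a m) + ∑ t ∈ Finset.Icc 1 T, dist (a t) (s t) ≤ pmCost D n a s := by
  rw [pmCost_eq]
  refine add_le_add (mul_le_mul_of_nonneg_left (dist_le_sum_Icc_dist a hm) hD) ?_
  exact Finset.sum_le_sum_of_subset_of_nonneg (Finset.Icc_subset_Icc_right hT)
    fun _ _ _ => dist_nonneg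

end PageMigration

/-- Staying at `0` serves `1^T 0^(n-T)` at cost `T`. -/
theorem pmOPT_ite_le {D : ℝ} (hD : 0 ≤ D) {T n : ℕ} (hT : T ≤ n) :
    pmOPT D x0 n (fun t => if t ≤ T then x1 else x0) ≤ T := by
  refine (pmOPT_le_pmCost hD n _ (b := fun _ => x0) rfl).trans_eq ?_
  have h : ∀ t, dist x0 (if t ≤ T then x1 else x0) = if t ≤ T then (1 : ℝ) else 0 := by
    intro t
    split_ifs <;> simp [dist_x0_x1]
  have hfilter : (Finset.Icc 1 n).filter (fun t => t ≤ T) = Finset.Icc 1 T := by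
    ext t
    simp only [Finset.mem_filter, Finset.mem_Icc]
    omega
  simp only [pmCost, dist_self, mul_zero, zero_add, h]
  rw [Finset.sum_boole, hfilter]
  simp

/-- Moving to `1` at once serves `1^n` at cost `D`. -/
theorem pmOPT_const_le {D : ℝ} (hD : 0 ≤ D) (n : ℕ) :
    pmOPT D x0 n (fun _ => x1) ≤ D := by
  refine (pmOPT_le_pmCost hD n _ (b := fun t => if t = 0 then x0 else x1) rfl).trans ?_
  have h : ∀ t ∈ Finset.Icc 1 n,
      D * dist (if t - 1 = 0 then x0 else x1) (if t = 0 then x0 else x1) +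
        dist (if t = 0 then x0 else x1) x1 = if t = 1 then D else 0 := by
    intro t ht
    have ht0 : t ≠ 0 := by
      have := (Finset.mem_Icc.mp ht).1
      omega
    by_cases ht1 : t = 1
    · simp [ht1, dist_x0_x1]
    · have : t - 1 ≠ 0 := by omega
      simp [ht0, ht1, this]
  rw [pmCost, Finset.sum_congr rfl h, Finset.sum_ite_eq']
  split_ifs
  exacts [le_rfl, hD]

/-- On `X = {0,1}` with start point `0`, let `D` be a positive integer and
`q ∈ (0, 1/2)` with `k = qD` a positive integer, and set `n = (1+q)D = D + k`. Let
`ŝ = 1^{(1−q)D} 0^{2qD}` and let `s¹ = ŝ`, `s² = 1^n`. Then for every deterministic online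
algorithm — given by functions `f t` depending only on the first `t` requests, inducing on
input `s` the position sequence `a_s 0 = 0`, `a_s t = f t s` — there exists `s ∈ {s¹, s²}`
with `cost(a_s, s) ≥ (1+q)·OPT(s)`. -/
theorem stmt12 (D k : ℕ) (hD : 0 < D) (hk : 0 < k)
    (q : ℝ) (hq0 : 0 < q) (hq2 : q < 1 / 2) (hkq : (k : ℝ) = q * D)
    (f : ℕ → (ℕ → X01) → X01)
    (hf : ∀ t : ℕ, ∀ s s' : ℕ → X01, (∀ u : ℕ, 1 ≤ u → u ≤ t → s u = s' u) → f t s = f t s') :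
    ∃ s : ℕ → X01,
      (s = (fun t => if t ≤ D - k then x1 else x0) ∨ s = fun _ => x1) ∧
      (1 + q) * pmOPT (D : ℝ) x0 (D + k) s ≤
        pmCost (D : ℝ) (D + k) (fun t => if t = 0 then x0 else f t s) s := by
  have hD' : (0 : ℝ) < D := by exact_mod_cast hD
  have hkD : 2 * (k : ℝ) ≤ D := by nlinarith
  have hkD_nat : k ≤ D := by
    have : 2 * k ≤ D := by exact_mod_cast hkD
    omega
  have hT : ((D - k : ℕ) : ℝ) = D - k := Nat.cast_sub hkD_nat
  have hTn : D - k ≤ D + k := by omega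
  by_cases hmove : ∃ t, 1 ≤ t ∧ t ≤ D - k ∧ f t (fun _ => x1) = x1
  · obtain ⟨t, ht1, htT, hft⟩ := hmove
    refine ⟨_, Or.inl rfl, ?_⟩
    set s : ℕ → X01 := fun t => if t ≤ D - k then x1 else x0
    have hfs : f t s = x1 :=
      (hf t s (fun _ => x1) fun u _ hu => if_pos (hu.trans htT)).trans hft
    have hcost := mul_dist_add_sum_le_pmCost hD'.le (htT.trans hTn) (Nat.zero_le (D + k))
      (fun t => if t = 0 then x0 else f t s) s
    have hopt : pmOPT (D : ℝ) x0 (D + k) s ≤ (D - k : ℕ) := pmOPT_ite_le hD'.le hTn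
    simp only [if_true, if_neg (Nat.one_le_iff_ne_zero.mp ht1), hfs, dist_x0_x1] at hcost
    norm_num at hcost
    rw [hT] at hopt
    nlinarith [mul_le_mul_of_nonneg_left hopt (by linarith : 0 ≤ 1 + q),
      mul_pos (mul_pos hq0 hq0) hD']
  · push Not at hmove
    refine ⟨_, Or.inr rfl, ?_⟩
    set a : ℕ → X01 := fun t => if t = 0 then x0 else f t (fun _ => x1) with ha
    have hopt := pmOPT_const_le hD'.le (D + k)
    have hbound : (1 + q) * pmOPT (D : ℝ) x0 (D + k) (fun _ => x1) ≤ D + k := by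
      nlinarith [mul_le_mul_of_nonneg_left hopt (by linarith : 0 ≤ 1 + q)]
    have hservice : ∀ T, (∀ t, 1 ≤ t → t ≤ T → a t ≠ x1) →
        ∑ t ∈ Finset.Icc 1 T, dist (a t) x1 = T := by
      intro T h
      rw [Finset.sum_congr rfl (g := fun _ => (1 : ℝ))]
      · simp
      · intro t ht
        obtain ⟨ht1, htT⟩ := Finset.mem_Icc.mp ht
        rw [(X01.eq_x0_or_eq_x1 (a t)).resolve_right (h t ht1 htT), dist_x0_x1]
    refine hbound.trans ?_
    by_cases hlate : ∃ t, t ≤ D + k ∧ a t = x1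
    · obtain ⟨t, htn, hat⟩ := hlate
      have hcost := mul_dist_add_sum_le_pmCost hD'.le htn hTn a (fun _ => x1)
      rw [hservice (D - k) fun t ht1 htT => by
        simpa [ha, Nat.one_le_iff_ne_zero.mp ht1] using hmove t ht1 htT, hat,
        show a 0 = x0 from rfl, dist_x0_x1, hT] at hcost
      linarith
    · push Not at hlate
      have hcost := mul_dist_add_sum_le_pmCost hD'.le (Nat.zero_le (D + k)) le_rfl a (fun _ => x1)
      rw [hservice (D + k) fun t _ htn => hlate t htn, dist_self] at hcost
      push_cast at hcost
      linarith
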